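/- There exist a real polynomial u and a real constant c > 0 such that the even Schwartz function f(x) = u(x²) e^{−x²/2} satisfies: (i) f(x) ≤ 0 for all x ≥ 2·arccosh(1 + √2); (ii) f̂(√(λ − 1/4)) ≥ c for all λ ∈ [1, 3.9]; (iii) f̂(√(λ − 1/4)) ≥ 0 for all λ ≥ 3.9; (iv) writing ℓ₁ = 2·arccosh(1 + √2), ℓ₂ = 2·arccosh(3 + 2√2), ℓ₃ = 2·arccosh(5 + 3√2), one has (1/c) · ( 2 ∫₀^∞ ξ f̂(ξ) tanh(πξ) dξ + (1/√(2π)) ( 12·ℓ₁·f(ℓ₁)/sinh(ℓ₁/2) + 12·ℓ₂·f(ℓ₂)/sinh(ℓ₂/2) + 24·ℓ₃·f(ℓ₃)/sinh(ℓ₃/2) ) − (1/√(2π)) ∫_ℝ f(x) cosh(x/2) dx ) < 4. -/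

import Mathlib

open Real MeasureTheory

/-- The even function `x ↦ u(x²) e^{-x²/2}` associated to a real polynomial `u`. -/
noncomputable def gaussPoly (u : Polynomial ℝ) (x : ℝ) : ℝ :=
  u.eval (x ^ 2) * Real.exp (-x ^ 2 / 2)

/-- The Fourier transform `f̂(ξ) = (1/√(2π)) ∫_ℝ f(x) e^{-iξx} dx` of an even real-valued
function, written in its real form `(1/√(2π)) ∫_ℝ f(x) cos(ξ x) dx`. -/
noncomputable def evenFT (f : ℝ → ℝ) (ξ : ℝ) : ℝ :=
  (1 / Real.sqrt (2 * π)) * ∫ x : ℝ, f x * Real.cos (ξ * x)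

/-- The inverse of `cosh` mapping `[1, ∞)` to `[0, ∞)`, given by its standard
logarithmic formula. -/
noncomputable def Real.arccosh (x : ℝ) : ℝ :=
  Real.log (x + Real.sqrt (x ^ 2 - 1))

/-- The polynomial `u` for the test function `f(x) = u(x²) e^{-x²/2}`. -/
noncomputable def bolzaPoly : Polynomial ℝ :=
  ∑ k : Fin 6, Polynomial.C
    ((![638889 / 25, 232853 / 50, 18209 / 50, -4089 / 100, 11 / 25, -1] : Fin 6 → ℝ) k) *
      Polynomial.X ^ (k : ℕ)

/-- The polynomial `v` for which the Fourier transform of `u(x²) e^{-x²/2}` is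
`v(ξ²) e^{-ξ²/2}`. -/
noncomputable def bolzaPolyFT (t : ℝ) : ℝ :=
  (t - 13 / 2) ^ 2 * (t - 17) ^ 2 * (t + 61 / 25)

theorem eval_bolzaPoly (t : ℝ) : bolzaPoly.eval t =
    638889 / 25 + 232853 / 50 * t + 18209 / 50 * t ^ 2 - 4089 / 100 * t ^ 3 + 11 / 25 * t ^ 4
      - t ^ 5 := by
  simp [bolzaPoly, Fin.sum_univ_succ]
  ring

theorem integrable_pow_mul_cexp_quadratic (n : ℕ) (z : ℂ) :
    Integrable fun x : ℝ ↦ (x : ℂ) ^ n * Complex.exp (-(1 / 2) * (x : ℂ) ^ 2 + z * x) := by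
  have h (w : ℝ) : Integrable fun x : ℝ ↦ Real.exp (-(1 / 2) * x ^ 2 + w * x) := by
    have := (integrable_cexp_quadratic' (b := -(1 / 2)) (by norm_num) (w : ℂ) 0).norm
    refine this.congr (.of_forall fun x ↦ ?_)
    simp only [Complex.norm_exp]
    congr 1
    have : (-(1 / 2) * (x : ℂ) ^ 2 + w * x + 0) = ((-(1 / 2) * x ^ 2 + w * x : ℝ) : ℂ) := by
      push_cast; ring
    rw [this, Complex.ofReal_re]
  refine (((h (z.re + 1)).add (h (z.re - 1))).const_mul (n.factorial : ℝ)).mono'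
    (by fun_prop) (.of_forall fun x ↦ ?_)
  have hre : (-(1 / 2) * (x : ℂ) ^ 2 + z * x).re = -(1 / 2) * x ^ 2 + z.re * x := by
    have : (-(1 / 2) * (x : ℂ) ^ 2 + z * x) = ((-(1 / 2) * x ^ 2 : ℝ) : ℂ) + z * x := by
      push_cast; ring
    rw [this, Complex.add_re, Complex.ofReal_re]
    simp
  have hpow : |x| ^ n ≤ n.factorial * Real.exp |x| := by
    have := Real.pow_div_factorial_le_exp |x| (abs_nonneg x) n
    rwa [div_le_iff₀' (by positivity)] at this
  have habs : Real.exp |x| ≤ Real.exp x + Real.exp (-x) := by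
    rcases abs_cases x with ⟨h, _⟩ | ⟨h, _⟩ <;> rw [h] <;>
      linarith [Real.exp_pos x, Real.exp_pos (-x)]
  rw [norm_mul, norm_pow, Complex.norm_real, Real.norm_eq_abs, Complex.norm_exp, hre]
  calc |x| ^ n * Real.exp (-(1 / 2) * x ^ 2 + z.re * x)
      ≤ n.factorial * (Real.exp x + Real.exp (-x)) *
          Real.exp (-(1 / 2) * x ^ 2 + z.re * x) := by
        gcongr
        exact hpow.trans (by gcongr)
    _ = _ := by
        simp only [Pi.add_apply]
        rw [mul_assoc, add_mul, ← Real.exp_add, ← Real.exp_add]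
        ring_nf

theorem hasDerivAt_pow_mul_cexp_quadratic (n : ℕ) (z : ℂ) (x : ℝ) :
    HasDerivAt (fun x : ℝ ↦ (x : ℂ) ^ n * Complex.exp (-(1 / 2) * (x : ℂ) ^ 2 + z * x))
      ((n * (x : ℂ) ^ (n - 1) + z * (x : ℂ) ^ n - (x : ℂ) ^ (n + 1)) *
        Complex.exp (-(1 / 2) * (x : ℂ) ^ 2 + z * x)) x := by
  have h1 : HasDerivAt (fun y : ℂ ↦ y ^ n * Complex.exp (-(1 / 2) * y ^ 2 + z * y))
      ((n * (x : ℂ) ^ (n - 1) + z * (x : ℂ) ^ n - (x : ℂ) ^ (n + 1)) *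
        Complex.exp (-(1 / 2) * (x : ℂ) ^ 2 + z * x)) x := by
    have h2 : HasDerivAt (fun y : ℂ ↦ -(1 / 2) * y ^ 2 + z * y) (-x + z) (x : ℂ) := by
      refine (((hasDerivAt_pow 2 (x : ℂ)).const_mul (-(1 / 2) : ℂ)).add
        ((hasDerivAt_id' (x : ℂ)).const_mul z)).congr_deriv ?_
      norm_num
      ring
    refine ((hasDerivAt_pow n (x : ℂ)).mul h2.cexp).congr_deriv ?_
    ring
  exact h1.comp_ofReal

/-- The moments of the complex Gaussian `e^{-x²/2 + zx}`. -/
noncomputable def gaussMoment (n : ℕ) (z : ℂ) : ℂ :=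
  ∫ x : ℝ, (x : ℂ) ^ n * Complex.exp (-(1 / 2) * (x : ℂ) ^ 2 + z * x)

theorem gaussMoment_zero (z : ℂ) :
    gaussMoment 0 z = (√(2 * π) : ℝ) * Complex.exp (z ^ 2 / 2) := by
  have h := integral_cexp_quadratic (b := -(1 / 2)) (by norm_num) z 0
  simp only [add_zero] at h
  simp only [gaussMoment, pow_zero, one_mul, h]
  have h1 : (π : ℂ) / -(-(1 / 2)) = ((2 * π : ℝ) : ℂ) := by push_cast; ring
  rw [h1, Real.sqrt_eq_rpow, Complex.ofReal_cpow (by positivity)]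
  push_cast
  congr 1
  ring_nf

theorem gaussMoment_succ (n : ℕ) (z : ℂ) :
    gaussMoment (n + 1) z = n * gaussMoment (n - 1) z + z * gaussMoment n z := by
  have hi (m : ℕ) := integrable_pow_mul_cexp_quadratic m z
  have heq : (fun x : ℝ ↦ (n * (x : ℂ) ^ (n - 1) + z * (x : ℂ) ^ n - (x : ℂ) ^ (n + 1)) *
        Complex.exp (-(1 / 2) * (x : ℂ) ^ 2 + z * x)) = fun x : ℝ ↦
      n * ((x : ℂ) ^ (n - 1) * Complex.exp (-(1 / 2) * (x : ℂ) ^ 2 + z * x)) +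
      z * ((x : ℂ) ^ n * Complex.exp (-(1 / 2) * (x : ℂ) ^ 2 + z * x)) -
      (x : ℂ) ^ (n + 1) * Complex.exp (-(1 / 2) * (x : ℂ) ^ 2 + z * x) := by
    ext x; ring
  have hi' : Integrable fun x : ℝ ↦
      n * ((x : ℂ) ^ (n - 1) * Complex.exp (-(1 / 2) * (x : ℂ) ^ 2 + z * x)) +
      z * ((x : ℂ) ^ n * Complex.exp (-(1 / 2) * (x : ℂ) ^ 2 + z * x)) :=
    ((hi (n - 1)).const_mul _).add ((hi n).const_mul _)
  have h := integral_eq_zero_of_hasDerivAt_of_integrable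
    (hasDerivAt_pow_mul_cexp_quadratic n z) (by rw [heq]; exact hi'.sub (hi (n + 1))) (hi n)
  rw [heq, integral_sub hi' (hi (n + 1)),
    integral_add ((hi (n - 1)).const_mul _) ((hi n).const_mul _), integral_const_mul,
    integral_const_mul] at h
  simp only [gaussMoment]
  linear_combination -h

theorem gaussPoly_bolzaPoly_mul_cexp (z : ℂ) (x : ℝ) :
    (gaussPoly bolzaPoly x : ℂ) * Complex.exp (z * x) =
      ∑ k : Fin 6, ((![638889 / 25, 232853 / 50, 18209 / 50, -4089 / 100, 11 / 25, -1] :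
        Fin 6 → ℂ) k) * ((x : ℂ) ^ (2 * (k : ℕ)) *
          Complex.exp (-(1 / 2) * (x : ℂ) ^ 2 + z * x)) := by
  have : -(1 / 2) * (x : ℂ) ^ 2 + z * x = -(x : ℂ) ^ 2 / 2 + z * x := by ring
  simp only [gaussPoly, eval_bolzaPoly, this, Complex.exp_add]
  simp [Fin.sum_univ_succ]
  ring

theorem integrable_gaussPoly_bolzaPoly_mul_cexp (z : ℂ) :
    Integrable fun x : ℝ ↦ (gaussPoly bolzaPoly x : ℂ) * Complex.exp (z * x) := by
  simp only [gaussPoly_bolzaPoly_mul_cexp]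
  exact integrable_finsetSum _ fun (k : Fin 6) _ ↦
    (integrable_pow_mul_cexp_quadratic (2 * (k : ℕ)) z).const_mul _

theorem integral_gaussPoly_bolzaPoly_mul_cexp (z : ℂ) :
    ∫ x : ℝ, (gaussPoly bolzaPoly x : ℂ) * Complex.exp (z * x) =
      (-z ^ 2 - 13 / 2) ^ 2 * (-z ^ 2 - 17) ^ 2 * (-z ^ 2 + 61 / 25) *
        ((√(2 * π) : ℝ) * Complex.exp (z ^ 2 / 2)) := by
  simp only [gaussPoly_bolzaPoly_mul_cexp, ← gaussMoment_zero]
  rw [integral_finsetSum _ fun (k : Fin 6) _ ↦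
    (integrable_pow_mul_cexp_quadratic (2 * (k : ℕ)) z).const_mul _]
  simp only [integral_const_mul]
  change ∑ k : Fin 6, _ * gaussMoment (2 * (k : ℕ)) z = _
  have h1 := gaussMoment_succ 0 z
  have h2 := gaussMoment_succ 1 z
  have h3 := gaussMoment_succ 2 z
  have h4 := gaussMoment_succ 3 z
  have h5 := gaussMoment_succ 4 z
  have h6 := gaussMoment_succ 5 z
  have h7 := gaussMoment_succ 6 z
  have h8 := gaussMoment_succ 7 z
  have h9 := gaussMoment_succ 8 z
  have h10 := gaussMoment_succ 9 z
  norm_num at h1 h2 h3 h4 h5 h6 h7 h8 h9 h10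
  simp only [Fin.sum_univ_succ, Fin.sum_univ_zero]
  norm_num [Fin.succ]
  rw [h10, h9, h8, h7, h6, h5, h4, h3, h2, h1]
  ring

theorem integral_gaussPoly_bolzaPoly_mul_ccosh (z : ℂ) :
    ∫ x : ℝ, (gaussPoly bolzaPoly x : ℂ) * Complex.cosh (z * x) =
      (-z ^ 2 - 13 / 2) ^ 2 * (-z ^ 2 - 17) ^ 2 * (-z ^ 2 + 61 / 25) *
        ((√(2 * π) : ℝ) * Complex.exp (z ^ 2 / 2)) := by
  have heq (x : ℝ) : (gaussPoly bolzaPoly x : ℂ) * Complex.cosh (z * x) =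
      1 / 2 * ((gaussPoly bolzaPoly x : ℂ) * Complex.exp (z * x)) +
        1 / 2 * ((gaussPoly bolzaPoly x : ℂ) * Complex.exp (-z * x)) := by
    rw [Complex.cosh, neg_mul]; ring
  simp only [heq]
  rw [integral_add ((integrable_gaussPoly_bolzaPoly_mul_cexp z).const_mul _)
    ((integrable_gaussPoly_bolzaPoly_mul_cexp (-z)).const_mul _), integral_const_mul,
    integral_const_mul, integral_gaussPoly_bolzaPoly_mul_cexp,
    integral_gaussPoly_bolzaPoly_mul_cexp, neg_sq]
  ring

theorem evenFT_gaussPoly_bolzaPoly (ξ : ℝ) :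
    evenFT (gaussPoly bolzaPoly) ξ = bolzaPolyFT (ξ ^ 2) * Real.exp (-ξ ^ 2 / 2) := by
  have h := integral_gaussPoly_bolzaPoly_mul_ccosh (ξ * Complex.I)
  have heq (x : ℝ) : (gaussPoly bolzaPoly x : ℂ) * Complex.cosh (ξ * Complex.I * x) =
      ((gaussPoly bolzaPoly x * Real.cos (ξ * x) : ℝ) : ℂ) := by
    rw [mul_right_comm, Complex.cosh_mul_I]
    push_cast
    rfl
  simp only [heq] at h
  rw [integral_complex_ofReal, mul_pow, Complex.I_sq] at h
  have h' : ∫ x : ℝ, gaussPoly bolzaPoly x * Real.cos (ξ * x) =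
      bolzaPolyFT (ξ ^ 2) * (√(2 * π) * Real.exp (-ξ ^ 2 / 2)) := by
    rw [← Complex.ofReal_inj, h, bolzaPolyFT]
    push_cast
    ring_nf
  have : √(2 * π) ≠ 0 := by positivity
  rw [evenFT, h']
  field_simp

theorem integral_gaussPoly_bolzaPoly_mul_cosh (a : ℝ) :
    1 / √(2 * π) * ∫ x : ℝ, gaussPoly bolzaPoly x * Real.cosh (a * x) =
      bolzaPolyFT (-a ^ 2) * Real.exp (a ^ 2 / 2) := by
  have h := integral_gaussPoly_bolzaPoly_mul_ccosh a
  have heq (x : ℝ) : (gaussPoly bolzaPoly x : ℂ) * Complex.cosh (a * x) =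
      ((gaussPoly bolzaPoly x * Real.cosh (a * x) : ℝ) : ℂ) := by
    push_cast
    rfl
  simp only [heq] at h
  rw [integral_complex_ofReal] at h
  have h' : ∫ x : ℝ, gaussPoly bolzaPoly x * Real.cosh (a * x) =
      bolzaPolyFT (-a ^ 2) * (√(2 * π) * Real.exp (a ^ 2 / 2)) := by
    rw [← Complex.ofReal_inj, h, bolzaPolyFT]
    push_cast
    ring_nf
  have : √(2 * π) ≠ 0 := by positivity
  rw [h']
  field_simp

theorem integrableOn_pow_mul_exp_neg_mul (m : ℕ) {a : ℝ} (ha : 0 < a) :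
    IntegrableOn (fun x : ℝ ↦ x ^ m * Real.exp (-(a * x))) (Set.Ioi 0) := by
  have h := integrableOn_rpow_mul_exp_neg_mul_rpow (p := 1) (s := m) (b := a)
    (by linarith [m.cast_nonneg (α := ℝ)]) one_pos ha
  simpa only [Real.rpow_natCast, Real.rpow_one, neg_mul] using h

theorem integral_pow_mul_exp_neg_mul (m : ℕ) {a : ℝ} (ha : 0 < a) :
    ∫ x in Set.Ioi (0 : ℝ), x ^ m * Real.exp (-(a * x)) = m.factorial / a ^ (m + 1) := by
  have h := Real.integral_rpow_mul_exp_neg_mul_Ioi (a := m + 1) (r := a) (by positivity) ha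
  simp only [add_sub_cancel_right, Real.rpow_natCast, Real.Gamma_nat_eq_factorial] at h
  rw [h, ← Nat.cast_add_one, Real.rpow_natCast, one_div, inv_pow, div_eq_inv_mul]

theorem integrableOn_pow_mul_exp_neg_sq_div_two (k : ℕ) :
    IntegrableOn (fun x : ℝ ↦ x ^ (2 * k + 1) * Real.exp (-x ^ 2 / 2)) (Set.Ioi 0) := by
  have h := integrableOn_rpow_mul_exp_neg_mul_sq (b := 1 / 2) (by norm_num)
    (s := ((2 * k + 1 : ℕ) : ℝ)) (by linarith [(2 * k + 1).cast_nonneg (α := ℝ)])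
  simp only [Real.rpow_natCast] at h
  refine h.congr_fun (fun x _ ↦ ?_) measurableSet_Ioi
  ring_nf

theorem integral_pow_mul_exp_neg_sq_div_two (k : ℕ) :
    ∫ x in Set.Ioi (0 : ℝ), x ^ (2 * k + 1) * Real.exp (-x ^ 2 / 2) =
      2 ^ k * k.factorial := by
  have h := integral_rpow_mul_exp_neg_mul_rpow (p := 2) (q := ((2 * k + 1 : ℕ) : ℝ))
    (b := 1 / 2) (by norm_num) (by linarith [(2 * k + 1).cast_nonneg (α := ℝ)]) (by norm_num)
  have e1 : (((2 * k + 1 : ℕ) : ℝ) + 1) / 2 = k + 1 := by push_cast; ring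
  have e2 : -(((2 * k + 1 : ℕ) : ℝ) + 1) / 2 = -((k + 1 : ℕ) : ℝ) := by push_cast; ring
  rw [e1, e2, Real.Gamma_nat_eq_factorial, Real.rpow_neg (by norm_num), Real.rpow_natCast] at h
  simp only [Real.rpow_natCast, Real.rpow_two] at h
  calc _ = ∫ x in Set.Ioi (0 : ℝ), x ^ (2 * k + 1) * Real.exp (-(1 / 2) * x ^ 2) := by
        congr 1; ext x; ring_nf
    _ = _ := by rw [h, pow_succ]; field_simp; rw [← mul_pow]; norm_num

theorem tanh_le_of_nonneg {x : ℝ} (hx : 0 ≤ x) :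
    Real.tanh x ≤ 1 - 2 * (Real.exp (-(2 * x)) - Real.exp (-(2 * x)) ^ 2 +
      Real.exp (-(2 * x)) ^ 3 / 2) := by
  have h0 : 0 < Real.exp (-x) := Real.exp_pos _
  have h1 : Real.exp (-x) ≤ 1 := Real.exp_le_one_iff.2 (by linarith)
  have hy : Real.exp (-(2 * x)) = Real.exp (-x) ^ 2 := by
    rw [← Real.exp_nat_mul]; congr 1; push_cast; ring
  have hinv : Real.exp x = (Real.exp (-x))⁻¹ := by rw [Real.exp_neg, inv_inv]
  rw [Real.tanh_eq, hy, hinv]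
  generalize Real.exp (-x) = q at h0 h1
  have hq : (q⁻¹ - q) / (q⁻¹ + q) = (1 - q ^ 2) / (1 + q ^ 2) := by field_simp
  rw [hq, div_le_iff₀ (by positivity)]
  nlinarith [mul_nonneg (pow_pos h0 6).le (sub_nonneg.2 (pow_le_one₀ h0.le h1 (n := 2)))]

theorem tanh_nonneg_of_nonneg {x : ℝ} (hx : 0 ≤ x) : 0 ≤ Real.tanh x := by
  rw [Real.tanh_eq_sinh_div_cosh]
  exact div_nonneg (Real.sinh_nonneg_iff.2 hx) (Real.cosh_pos x).le

theorem bolzaPolyFT_nonneg {t : ℝ} (ht : 0 ≤ t) : 0 ≤ bolzaPolyFT t := by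
  unfold bolzaPolyFT
  positivity

theorem gaussian_mul_tanh_le {x : ℝ} (hx : 0 ≤ x) :
    x * (bolzaPolyFT (x ^ 2) * Real.exp (-x ^ 2 / 2)) * Real.tanh (π * x) ≤
      x * bolzaPolyFT (x ^ 2) * Real.exp (-x ^ 2 / 2) -
        x * bolzaPolyFT (x ^ 2) * (1 - x ^ 2 / 2) * (2 * (Real.exp (-(2 * (π * x))) -
          Real.exp (-(2 * (π * x))) ^ 2 + Real.exp (-(2 * (π * x))) ^ 3 / 2)) := by
  have hv := mul_nonneg hx (bolzaPolyFT_nonneg (sq_nonneg x))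
  have ht := tanh_le_of_nonneg (x := π * x) (by positivity)
  have hy0 := Real.exp_pos (-(2 * (π * x)))
  have hy1 : Real.exp (-(2 * (π * x))) ≤ 1 := by
    rw [Real.exp_le_one_iff, neg_nonpos]; positivity
  have he := Real.add_one_le_exp (-x ^ 2 / 2)
  generalize Real.exp (-(2 * (π * x))) = y at *
  have hg : 0 ≤ 2 * (y - y ^ 2 + y ^ 3 / 2) := by
    have := mul_nonneg hy0.le (sub_nonneg.2 hy1)
    have := pow_pos hy0 3
    linarith
  have h1 := mul_le_mul_of_nonneg_left ht (mul_nonneg hv (Real.exp_pos (-x ^ 2 / 2)).le)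
  have h2 := mul_le_mul_of_nonneg_left (mul_le_mul_of_nonneg_right he hg) hv
  linarith

theorem integral_mul_evenFT_mul_tanh_le :
    ∫ x in Set.Ioi (0 : ℝ), x * evenFT (gaussPoly bolzaPoly) x * Real.tanh (π * x) ≤
      2075539 / 100 - ∑ k : Fin 7,
        (![2979301 / 100, -3071679 / 200, -123033 / 40, 462391 / 200, -74769 / 200, 582 / 25,
          -1 / 2] : Fin 7 → ℝ) k * ∑ n : Fin 3, (![2, -2, 1] : Fin 3 → ℝ) n *
            ((2 * k + 1 : ℕ).factorial / (2 * π * (n + 1 : ℕ)) ^ (2 * (k : ℕ) + 1 + 1)) := by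
  let a : Fin 6 → ℝ :=
    ![2979301 / 100, -46189 / 100, -330677 / 100, 65857 / 100, -1114 / 25, 1]
  let b : Fin 7 → ℝ := ![2979301 / 100, -3071679 / 200, -123033 / 40, 462391 / 200,
    -74769 / 200, 582 / 25, -1 / 2]
  let w : Fin 3 → ℝ := ![2, -2, 1]
  let F (x : ℝ) : ℝ := ∑ k : Fin 6, a k * (x ^ (2 * (k : ℕ) + 1) * Real.exp (-x ^ 2 / 2))
  let G (x : ℝ) : ℝ := ∑ k : Fin 7, b k * ∑ n : Fin 3, w n *
    (x ^ (2 * (k : ℕ) + 1) * Real.exp (-(2 * π * (n + 1 : ℕ) * x)))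
  have hFi (k : Fin 6) : IntegrableOn
      (fun x ↦ a k * (x ^ (2 * (k : ℕ) + 1) * Real.exp (-x ^ 2 / 2))) (Set.Ioi 0) :=
    (integrableOn_pow_mul_exp_neg_sq_div_two k).const_mul _
  have hpos (n : Fin 3) : 0 < 2 * π * (n + 1 : ℕ) := by positivity
  have hGi' (k : Fin 7) (n : Fin 3) : IntegrableOn (fun x : ℝ ↦ w n *
      (x ^ (2 * (k : ℕ) + 1) * Real.exp (-(2 * π * (n + 1 : ℕ) * x)))) (Set.Ioi 0) :=
    (integrableOn_pow_mul_exp_neg_mul _ (hpos n)).const_mul _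
  have hGi (k : Fin 7) : IntegrableOn (fun x : ℝ ↦ b k * ∑ n : Fin 3, w n *
      (x ^ (2 * (k : ℕ) + 1) * Real.exp (-(2 * π * (n + 1 : ℕ) * x)))) (Set.Ioi 0) :=
    (integrable_finsetSum _ fun n _ ↦ hGi' k n).const_mul _
  have hF : IntegrableOn F (Set.Ioi 0) := integrable_finsetSum _ fun k _ ↦ hFi k
  have hG : IntegrableOn G (Set.Ioi 0) := integrable_finsetSum _ fun k _ ↦ hGi k
  have hle : ∫ x in Set.Ioi (0 : ℝ), x * evenFT (gaussPoly bolzaPoly) x * Real.tanh (π * x) ≤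
      ∫ x in Set.Ioi (0 : ℝ), (F x - G x) := by
    refine integral_mono_of_nonneg ?_ (hF.sub hG) ?_
    · refine (ae_restrict_iff' measurableSet_Ioi).2 (.of_forall fun x (hx : 0 < x) ↦ ?_)
      simp only [Pi.zero_apply, evenFT_gaussPoly_bolzaPoly]
      exact mul_nonneg (mul_nonneg hx.le (mul_nonneg (bolzaPolyFT_nonneg (sq_nonneg x))
        (Real.exp_pos _).le)) (tanh_nonneg_of_nonneg (by positivity))
    · refine (ae_restrict_iff' measurableSet_Ioi).2 (.of_forall fun x (hx : 0 < x) ↦ ?_)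
      simp only [evenFT_gaussPoly_bolzaPoly]
      refine (gaussian_mul_tanh_le hx.le).trans_eq ?_
      have hexp (n : ℕ) : Real.exp (-(2 * π * n * x)) = Real.exp (-(2 * (π * x))) ^ n := by
        rw [← Real.exp_nat_mul]; congr 1; ring
      simp only [F, G, hexp]
      simp [a, b, w, Fin.sum_univ_succ, bolzaPolyFT]
      ring
  refine hle.trans_eq ?_
  rw [integral_sub hF hG]
  congr 1
  · rw [integral_finsetSum _ fun k _ ↦ hFi k]
    simp only [integral_const_mul, integral_pow_mul_exp_neg_sq_div_two]
    norm_num [a, Fin.sum_univ_succ, Nat.factorial]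
  · rw [integral_finsetSum _ fun k _ ↦ hGi k]
    simp only [integral_const_mul]
    refine Finset.sum_congr rfl fun k _ ↦ ?_
    rw [integral_finsetSum _ fun n _ ↦ hGi' k n]
    simp only [integral_const_mul, integral_pow_mul_exp_neg_mul _ (hpos _)]
    rfl

theorem le_two_mul_arccosh : (3.0562 : ℝ) ≤ 2 * Real.arccosh (1 + √2) := by
  have h2 : (1.41421 : ℝ) ≤ √2 := Real.le_sqrt_of_sq_le (by norm_num)
  have h3 : (2.19736 : ℝ) ≤ √((1 + √2) ^ 2 - 1) :=
    Real.le_sqrt_of_sq_le (by nlinarith)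
  have h : (1.5281 : ℝ) ≤ Real.arccosh (1 + √2) := by
    rw [Real.arccosh, Real.le_log_iff_exp_le (by positivity)]
    have he : Real.exp 1.5281 = Real.exp 0.76405 ^ 2 := by
      rw [← Real.exp_nat_mul]; norm_num
    have hb := Real.exp_bound' (x := 0.76405) (by norm_num) (by norm_num) (n := 8) (by norm_num)
    have hb' : Real.exp 0.76405 ≤ 2.14698 := by
      refine hb.trans ?_
      norm_num [Finset.sum_range_succ, Nat.factorial]
    rw [he]
    nlinarith [Real.exp_pos 0.76405]
  linarith

theorem arccosh_le_arccosh {x y : ℝ} (hx : 1 ≤ x) (hxy : x ≤ y) :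
    Real.arccosh x ≤ Real.arccosh y := by
  unfold Real.arccosh
  gcongr

theorem gaussPoly_bolzaPoly_nonpos {x : ℝ} (hx : 2 * Real.arccosh (1 + √2) ≤ x) :
    gaussPoly bolzaPoly x ≤ 0 := by
  have h1 := le_two_mul_arccosh.trans hx
  have h2 : (9.34 : ℝ) ≤ x ^ 2 := by nlinarith
  refine mul_nonpos_of_nonpos_of_nonneg ?_ (Real.exp_pos _).le
  rw [eval_bolzaPoly]
  obtain ⟨r, hr, hxr⟩ : ∃ r : ℝ, 0 ≤ r ∧ x ^ 2 = 9.34 + r := ⟨x ^ 2 - 9.34, by linarith, by ring⟩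
  rw [hxr, ← sub_nonneg]
  ring_nf
  positivity

theorem length_term_nonpos {y : ℝ} (hy : 1 + √2 ≤ y) :
    2 * Real.arccosh y * gaussPoly bolzaPoly (2 * Real.arccosh y) /
      Real.sinh (2 * Real.arccosh y / 2) ≤ 0 := by
  have h : 2 * Real.arccosh (1 + √2) ≤ 2 * Real.arccosh y := by
    gcongr
    exact arccosh_le_arccosh (by linarith [Real.sqrt_nonneg 2]) hy
  have h0 : 0 ≤ 2 * Real.arccosh y := by linarith [le_two_mul_arccosh]
  exact div_nonpos_of_nonpos_of_nonneg
    (mul_nonpos_of_nonneg_of_nonpos h0 (gaussPoly_bolzaPoly_nonpos h))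
    (Real.sinh_nonneg_iff.2 (by positivity))

theorem bolzaPolyFT_mul_exp_anti {t : ℝ} (h0 : 0 ≤ t) (ht : t ≤ 73 / 20) :
    bolzaPolyFT (73 / 20) * Real.exp (-(73 / 20) / 2) ≤
      bolzaPolyFT t * Real.exp (-t / 2) := by
  have he : Real.exp (-t / 2) = Real.exp ((73 / 20 - t) / 2) * Real.exp (-(73 / 20) / 2) := by
    rw [← Real.exp_add]; congr 1; ring
  rw [he, ← mul_assoc]
  gcongr
  have h1 := Real.add_one_le_exp ((73 / 20 - t) / 2)
  have h2 : (73 / 20 + 61 / 25 : ℝ) ≤ (t + 61 / 25) * Real.exp ((73 / 20 - t) / 2) := by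
    nlinarith
  have h3 : (73 / 20 - 13 / 2 : ℝ) ^ 2 ≤ (t - 13 / 2) ^ 2 := by nlinarith
  have h4 : (73 / 20 - 17 : ℝ) ^ 2 ≤ (t - 17) ^ 2 := by nlinarith
  unfold bolzaPolyFT
  rw [mul_assoc _ (t + 61 / 25)]
  gcongr

theorem bolza_bound_lt :
    2 * (2075539 / 100 - ∑ k : Fin 7,
        (![2979301 / 100, -3071679 / 200, -123033 / 40, 462391 / 200, -74769 / 200, 582 / 25,
          -1 / 2] : Fin 7 → ℝ) k * ∑ n : Fin 3, (![2, -2, 1] : Fin 3 → ℝ) n *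
            ((2 * k + 1 : ℕ).factorial / (2 * π * (n + 1 : ℕ)) ^ (2 * (k : ℕ) + 1 + 1))) -
      bolzaPolyFT (-(1 / 2) ^ 2) * Real.exp ((1 / 2) ^ 2 / 2) <
    4 * (bolzaPolyFT (73 / 20) * Real.exp (-(73 / 20) / 2)) := by
  have hw : ∃ w : ℝ, 0.0253302 ≤ w ∧ w ≤ 0.0253304 ∧ w = 1 / (2 * π) ^ 2 := by
    refine ⟨_, ?_, ?_, rfl⟩
    · rw [le_div_iff₀ (by positivity)]
      nlinarith [Real.pi_lt_d6, Real.pi_gt_d6]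
    · rw [div_le_iff₀ (by positivity)]
      nlinarith [Real.pi_lt_d6, Real.pi_gt_d6]
  obtain ⟨w, hw1, hw2, hw⟩ := hw
  have hpow (k n : ℕ) : (2 * π * (n + 1 : ℕ)) ^ (2 * k + 1 + 1) =
      ((n + 1 : ℕ) : ℝ) ^ (2 * k + 2) / w ^ (k + 1) := by
    have hwi : (2 * π) ^ 2 = w⁻¹ := by rw [hw, one_div, inv_inv]
    rw [mul_pow, show 2 * k + 1 + 1 = 2 * (k + 1) by ring, pow_mul (2 * π), hwi, inv_pow,
      inv_mul_eq_div, mul_add_one]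
  have he1 : (1.1331 : ℝ) ≤ Real.exp ((1 / 2) ^ 2 / 2) := by
    refine le_trans ?_ (Real.sum_le_exp_of_nonneg (by norm_num) 5)
    norm_num [Finset.sum_range_succ, Nat.factorial]
  have he2 : (0.1612 : ℝ) ≤ Real.exp (-(73 / 20) / 2) := by
    have h : Real.exp (73 / 80) ≤ 2.4906 := by
      refine (Real.exp_bound' (by norm_num) (by norm_num) (n := 8) (by norm_num)).trans ?_
      norm_num [Finset.sum_range_succ, Nat.factorial]
    have h' : Real.exp (-(73 / 20) / 2) = (Real.exp (73 / 80) ^ 2)⁻¹ := by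
      rw [← Real.exp_nat_mul, ← Real.exp_neg]; norm_num
    rw [h']
    refine le_trans (b := ((2.4906 : ℝ) ^ 2)⁻¹) (by norm_num) ?_
    gcongr
  have hl (k : ℕ) : (0.0253302 : ℝ) ^ k ≤ w ^ k := by gcongr
  have hu (k : ℕ) : w ^ k ≤ (0.0253304 : ℝ) ^ k := by gcongr
  simp only [hpow]
  simp [Fin.sum_univ_succ, Nat.factorial, bolzaPolyFT]
  norm_num
  have l1 := hl 1
  have u2 := hu 2
  have u3 := hu 3
  have l4 := hl 4
  have u5 := hu 5
  have l6 := hl 6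
  have u7 := hu 7
  norm_num at l1 u2 u3 l4 u5 l6 u7 he1 he2 ⊢
  linarith

theorem stmt_9 :
    ∃ (u : Polynomial ℝ) (c : ℝ), 0 < c ∧
      (let f : ℝ → ℝ := gaussPoly u
      let fhat : ℝ → ℝ := evenFT f
      let L₁ : ℝ := 2 * Real.arccosh (1 + Real.sqrt 2)
      let L₂ : ℝ := 2 * Real.arccosh (3 + 2 * Real.sqrt 2)
      let L₃ : ℝ := 2 * Real.arccosh (5 + 3 * Real.sqrt 2)
      (∀ x : ℝ, 2 * Real.arccosh (1 + Real.sqrt 2) ≤ x → f x ≤ 0) ∧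
      (∀ lam : ℝ, lam ∈ Set.Icc (1 : ℝ) 3.9 → fhat (Real.sqrt (lam - 1 / 4)) ≥ c) ∧
      (∀ lam : ℝ, (3.9 : ℝ) ≤ lam → fhat (Real.sqrt (lam - 1 / 4)) ≥ 0) ∧
      (1 / c) *
          (2 * (∫ ξ in Set.Ioi (0 : ℝ), ξ * fhat ξ * Real.tanh (π * ξ))
            + (1 / Real.sqrt (2 * π)) * (12 * L₁ * f L₁ / Real.sinh (L₁ / 2) + 12 * L₂ * f L₂ / Real.sinh (L₂ / 2) + 24 * L₃ * f L₃ / Real.sinh (L₃ / 2))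
            - (1 / Real.sqrt (2 * π)) * ∫ x : ℝ, f x * Real.cosh (x / 2)) < 4) := by
  have hc : 0 < bolzaPolyFT (73 / 20) * Real.exp (-(73 / 20) / 2) := by
    unfold bolzaPolyFT
    positivity
  refine ⟨bolzaPoly, bolzaPolyFT (73 / 20) * Real.exp (-(73 / 20) / 2), hc,
    fun x hx ↦ gaussPoly_bolzaPoly_nonpos hx, fun lam hlam ↦ ?_, fun lam hlam ↦ ?_, ?_⟩
  · have h1 := hlam.1
    have h2 := hlam.2
    rw [evenFT_gaussPoly_bolzaPoly, Real.sq_sqrt (by linarith)]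
    exact bolzaPolyFT_mul_exp_anti (by linarith) (by norm_num at h2 ⊢; linarith)
  · rw [evenFT_gaussPoly_bolzaPoly]
    exact mul_nonneg (bolzaPolyFT_nonneg (sq_nonneg _)) (Real.exp_pos _).le
  · have hcosh := integral_gaussPoly_bolzaPoly_mul_cosh (1 / 2)
    have hhalf (x : ℝ) : 1 / 2 * x = x / 2 := by ring
    simp only [hhalf] at hcosh
    have h2 := Real.sqrt_nonneg 2
    have hL₁ := length_term_nonpos (y := 1 + √2) le_rfl
    have hL₂ := length_term_nonpos (y := 3 + 2 * √2) (by linarith)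
    have hL₃ := length_term_nonpos (y := 5 + 3 * √2) (by linarith)
    have hL := mul_nonpos_of_nonneg_of_nonpos (a := 1 / √(2 * π)) (by positivity)
      (add_nonpos (add_nonpos (mul_nonpos_of_nonneg_of_nonpos (by norm_num : (0 : ℝ) ≤ 12) hL₁)
        (mul_nonpos_of_nonneg_of_nonpos (by norm_num : (0 : ℝ) ≤ 12) hL₂))
        (mul_nonpos_of_nonneg_of_nonpos (by norm_num : (0 : ℝ) ≤ 24) hL₃))
    simp only [← mul_div_assoc, ← mul_assoc] at hL
    have hI := integral_mul_evenFT_mul_tanh_le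
    have hB := bolza_bound_lt
    rw [one_div, inv_mul_lt_iff₀ hc, hcosh]
    simp only [← mul_assoc] at hL ⊢
    linarith
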